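/- Suppose p ∈ {2,3}, p does not divide k, and q > d^2 where d := gcd(k, q−1). If n > 3 and q^n > (k−1)^4, then every matrix in M_n(𝔽_q) can be written as A^k + B^k with A, B ∈ M_n(𝔽_q). -/

import Mathlib

theorem gl_energy {F : Type*} [Field F] [DecidableEq F] (H : Finset F) (ξ : F) :
    (H.card ^ 2) ^ 2 ≤ ((H ×ˢ H).image (fun x : F × F => x.1 + ξ * x.2)).card *
      (((H ×ˢ H) ×ˢ (H ×ˢ H)).filter
        (fun z => z.1.1 + ξ * z.1.2 = z.2.1 + ξ * z.2.2)).card := by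
  set f : F × F → F := fun x => x.1 + ξ * x.2 with hf
  have h1 : (H ×ˢ H).card = ∑ y ∈ (H ×ˢ H).image f, ((H ×ˢ H).filter (fun x => f x = y)).card :=
    Finset.card_eq_sum_card_image f _
  have h2 : (((H ×ˢ H) ×ˢ (H ×ˢ H)).filter
        (fun z => z.1.1 + ξ * z.1.2 = z.2.1 + ξ * z.2.2)).card
      = ∑ y ∈ (H ×ˢ H).image f, ((H ×ˢ H).filter (fun x => f x = y)).card ^ 2 := by
    rw [Finset.card_eq_sum_card_fiberwise (f := fun z => f z.1) (t := (H ×ˢ H).image f)]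
    · refine Finset.sum_congr rfl fun y hy => ?_
      rw [sq, ← Finset.card_product]
      congr 1
      ext ⟨x, z⟩
      simp only [Finset.mem_filter, Finset.mem_product, hf]
      constructor
      · rintro ⟨⟨⟨a, b⟩, c⟩, d⟩
        exact ⟨⟨a, d⟩, b, c ▸ d⟩
      · rintro ⟨⟨a, d⟩, b, c⟩
        exact ⟨⟨⟨a, b⟩, d.trans c.symm⟩, d⟩
    · intro z hz
      simp only [Finset.coe_filter, Finset.mem_product, Set.mem_ofPred_eq] at hz
      exact Finset.mem_coe.2 (Finset.mem_image_of_mem f (Finset.mem_product.2 hz.1.1))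
  rw [h2, sq H.card, ← Finset.card_product, h1]
  exact sq_sum_le_card_mul_sum_sq

theorem gl_count {F : Type*} [Field F] [Fintype F] [DecidableEq F] (H : Finset F) :
    ∑ ξ ∈ Finset.univ.erase (0 : F), (((H ×ˢ H) ×ˢ (H ×ˢ H)).filter
        (fun z => z.1.1 + ξ * z.1.2 = z.2.1 + ξ * z.2.2)).card
      ≤ (Fintype.card F - 1) * H.card ^ 2 + (H.card * (H.card - 1)) ^ 2 := by
  simp_rw [Finset.card_filter]
  rw [Finset.sum_comm]
  have key : ∀ z ∈ (H ×ˢ H) ×ˢ (H ×ˢ H), (∑ ξ ∈ Finset.univ.erase (0 : F),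
      if z.1.1 + ξ * z.1.2 = z.2.1 + ξ * z.2.2 then 1 else 0)
      ≤ (Fintype.card F - 1) * (if z.1 = z.2 then 1 else 0) +
        (if z.1.1 ≠ z.2.1 ∧ z.1.2 ≠ z.2.2 then 1 else 0) := by
    rintro ⟨⟨a, b⟩, ⟨c, d⟩⟩ -
    rw [← Finset.card_filter]
    by_cases h : (a, b) = (c, d)
    · simp only [h, if_true]
      refine (Finset.card_filter_le _ _).trans ?_
      rw [Finset.card_erase_of_mem (Finset.mem_univ _), Finset.card_univ]
      omega
    · by_cases h2 : a ≠ c ∧ b ≠ d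
      · simp only [h, if_false, h2, mul_zero, zero_add, ne_eq, not_false_eq_true, and_self, if_true]
        rw [Finset.card_le_one]
        intro x hx y hy
        simp only [Finset.mem_filter] at hx hy
        have hbd : b - d ≠ 0 := sub_ne_zero.2 h2.2
        have : (x - y) * (b - d) = 0 := by linear_combination hx.2 - hy.2
        rcases mul_eq_zero.1 this with h | h
        · exact sub_eq_zero.1 h
        · exact absurd h hbd
      · have : (Finset.univ.erase (0 : F)).filter (fun ξ => a + ξ * b = c + ξ * d) = ∅ := by
          rw [Finset.filter_eq_empty_iff]
          intro ξ hξ he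
          have hξ0 : ξ ≠ 0 := Finset.ne_of_mem_erase hξ
          apply h2
          constructor
          · rintro rfl
            apply h
            have : ξ * b = ξ * d := by linear_combination he
            rw [mul_left_cancel₀ hξ0 this]
          · rintro rfl
            apply h
            have : a = c := by linear_combination he
            rw [this]
        simp only [this, Finset.card_empty, Nat.zero_le]
  refine (Finset.sum_le_sum key).trans ?_
  rw [Finset.sum_add_distrib, ← Finset.mul_sum, ← Finset.card_filter, ← Finset.card_filter]
  gcongr
  · rw [sq, ← Finset.card_product]
    apply Finset.card_le_card_of_injOn (fun z => z.1)
    · intro z hz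
      simp only [Finset.coe_filter, Finset.mem_product, Set.mem_ofPred_eq] at hz
      exact Finset.mem_coe.2 (Finset.mem_product.2 hz.1.1)
    · rintro ⟨x, y⟩ hz ⟨x', y'⟩ hw h
      simp only [Finset.coe_filter, Set.mem_ofPred_eq] at hz hw h
      rw [← hz.2, ← hw.2, h]
  · have : H.card * (H.card - 1) = H.offDiag.card := by
      rw [Finset.offDiag_card, Nat.mul_sub, mul_one]
    rw [this, sq, ← Finset.card_product]
    apply Finset.card_le_card_of_injOn (fun z => ((z.1.1, z.2.1), (z.1.2, z.2.2)))
    · rintro ⟨⟨a, b⟩, ⟨c, d⟩⟩ hz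
      simp only [Finset.coe_filter, Finset.mem_product, Set.mem_ofPred_eq] at hz
      simp only [Finset.coe_product, Set.mem_prod, Finset.mem_coe, Finset.mem_offDiag]
      tauto
    · rintro ⟨⟨a, b⟩, ⟨c, d⟩⟩ hz ⟨⟨a', b'⟩, ⟨c', d'⟩⟩ hw h
      simp only [Prod.mk.injEq] at h ⊢
      tauto

theorem gl_energy_neg {F : Type*} [Field F] [DecidableEq F] (H : Finset F) (ξ : F) :
    (((H ×ˢ H) ×ˢ (H ×ˢ H)).filter
        (fun z => z.1.1 + (-ξ) * z.1.2 = z.2.1 + (-ξ) * z.2.2)).card ≤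
    (((H ×ˢ H) ×ˢ (H ×ˢ H)).filter
        (fun z => z.1.1 + ξ * z.1.2 = z.2.1 + ξ * z.2.2)).card := by
  apply Finset.card_le_card_of_injOn (fun z => ((z.1.1, z.2.2), (z.2.1, z.1.2)))
  · rintro ⟨⟨a, b⟩, ⟨c, d⟩⟩ hz
    simp only [Finset.coe_filter, Finset.mem_product, Set.mem_ofPred_eq] at hz ⊢
    refine ⟨by tauto, by linear_combination hz.2⟩
  · rintro ⟨⟨a, b⟩, ⟨c, d⟩⟩ hz ⟨⟨a', b'⟩, ⟨c', d'⟩⟩ hw h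
    simp only [Prod.mk.injEq] at h ⊢
    tauto

theorem gl_xi {F : Type*} [Field F] [Fintype F] [DecidableEq F] (H : Finset F)
    (h0 : (0 : F) ∉ H) (hcard : Fintype.card F < H.card ^ 2) :
    ∃ ξ : F, ξ ≠ 0 ∧ Fintype.card F <
      2 * ((H ×ˢ H).image (fun x : F × F => x.1 + ξ * x.2)).card ∧ Fintype.card F <
      2 * ((H ×ˢ H).image (fun x : F × F => x.1 + (-ξ) * x.2)).card := by
  by_contra! hcon
  have hq1 : 1 < Fintype.card F := Fintype.one_lt_card
  have heq : H.card + 1 ≤ Fintype.card F := by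
    have := Finset.card_le_univ (insert 0 H)
    rwa [Finset.card_insert_of_notMem h0] at this
  have hsum : ∑ ξ ∈ Finset.univ.erase (0 : F), 2 * (H.card ^ 2) ^ 2 ≤
      ∑ ξ ∈ Finset.univ.erase (0 : F), Fintype.card F *
        (((H ×ˢ H) ×ˢ (H ×ˢ H)).filter
        (fun z => z.1.1 + ξ * z.1.2 = z.2.1 + ξ * z.2.2)).card := by
    refine Finset.sum_le_sum fun ξ hξ => ?_
    by_cases hc : Fintype.card F <
      2 * ((H ×ˢ H).image (fun x : F × F => x.1 + ξ * x.2)).card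
    · have hc2 := hcon ξ (Finset.ne_of_mem_erase hξ) hc
      calc 2 * (H.card ^ 2) ^ 2 ≤ 2 * (_ * _) := Nat.mul_le_mul_left 2 (gl_energy H (-ξ))
        _ = (2 * _) * _ := (mul_assoc _ _ _).symm
        _ ≤ _ := Nat.mul_le_mul hc2 (gl_energy_neg H ξ)
    · calc 2 * (H.card ^ 2) ^ 2 ≤ 2 * (_ * _) := Nat.mul_le_mul_left 2 (gl_energy H ξ)
        _ = (2 * _) * _ := (mul_assoc _ _ _).symm
        _ ≤ _ := Nat.mul_le_mul_right _ (not_lt.1 hc)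
  rw [Finset.sum_const, ← Finset.mul_sum, Finset.card_erase_of_mem (Finset.mem_univ _),
    Finset.card_univ, smul_eq_mul] at hsum
  have h3 := hsum.trans (Nat.mul_le_mul_left _ (gl_count H))
  clear hsum hcon
  generalize H.card = e at *
  generalize Fintype.card F = q at *
  obtain ⟨r, rfl⟩ : ∃ r, q = r + 1 := ⟨q - 1, by omega⟩
  have he : e ≠ 0 := by rintro rfl; simp at hcard
  obtain ⟨m, rfl⟩ : ∃ m, e = m + 1 := ⟨e - 1, by omega⟩
  simp only [Nat.add_sub_cancel] at h3
  have h4 : (m + 1) ^ 2 * (2 * r * (m + 1) ^ 2) ≤ (m + 1) ^ 2 * ((r + 1) * (r + m ^ 2)) := by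
    nlinarith [h3]
  have h5 := Nat.le_of_mul_le_mul_left h4 (by positivity)
  nlinarith

theorem gl_half {F : Type*} [Field F] [Fintype F] [DecidableEq F] (X : Finset F)
    (h : Fintype.card F < 2 * X.card) (t : F) : ∃ x ∈ X, ∃ y ∈ X, x + y = t := by
  have : (X ∩ X.image (fun x => t - x)).Nonempty := by
    apply Finset.inter_nonempty_of_card_lt_card_add_card (Finset.subset_univ _) (Finset.subset_univ _)
    rw [Finset.card_image_of_injective _ (sub_right_injective), Finset.card_univ]
    omega
  obtain ⟨x, hx⟩ := this
  rw [Finset.mem_inter, Finset.mem_image] at hx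
  obtain ⟨hx, y, hy, rfl⟩ := hx
  exact ⟨_, hx, y, hy, by ring⟩

theorem gl_four {F : Type*} [Field F] [Fintype F] [DecidableEq F] (H : Finset F)
    (h0 : (0 : F) ∉ H) (hmul : ∀ a ∈ H, ∀ b ∈ H, a * b ∈ H) (hinv : ∀ a ∈ H, a⁻¹ ∈ H)
    (hcard : Fintype.card F < H.card ^ 2) :
    ∃ u v w z : F, u ∈ H ∧ v ∈ H ∧ w ∈ H ∧ z ∈ H ∧ Fintype.card F <
      2 * ((H ×ˢ H).image (fun x : F × F => (u + v) * x.1 + (w + z) * x.2)).card := by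
  obtain ⟨ξ, hξ, hX, hX2⟩ := gl_xi H h0 hcard
  have main : ∀ u v w z : F, u + v ≠ 0 → w + z = ξ * (u + v) → Fintype.card F <
      2 * ((H ×ˢ H).image (fun x : F × F => (u + v) * x.1 + (w + z) * x.2)).card := by
    intro u v w z h1 h2
    have : (H ×ˢ H).image (fun x : F × F => (u + v) * x.1 + (w + z) * x.2) =
        ((H ×ˢ H).image (fun x : F × F => x.1 + ξ * x.2)).image (fun y => (u + v) * y) := by
      rw [Finset.image_image]
      congr 1
      ext x
      simp only [Function.comp, h2]
      ring
    rw [this, Finset.card_image_of_injective _ (mul_right_injective₀ h1)]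
    exact hX
  by_cases hneg : (-1 : F) ∈ H
  · have hnegm : ∀ a ∈ H, -a ∈ H := fun a ha => by simpa using hmul _ hneg _ ha
    obtain ⟨x, hx, y, hy, hne, he⟩ := Finset.exists_ne_map_eq_of_card_lt_of_maps_to
      (s := H ×ˢ H) (t := Finset.univ) (f := fun x : F × F => x.1 + ξ * x.2)
      (by rw [Finset.card_product, Finset.card_univ, ← sq]; exact hcard) (fun _ _ => Finset.mem_coe.2 (Finset.mem_univ _))
    obtain ⟨a, b⟩ := x
    obtain ⟨c, d⟩ := y
    simp only [Finset.mem_product] at hx hy he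
    refine ⟨d, -b, a, -c, hy.2, hnegm _ hx.2, hx.1, hnegm _ hy.1, main _ _ _ _ ?_ ?_⟩
    · intro h
      have hdb : d = b := by linear_combination h
      subst hdb
      exact hne (by rw [show a = c by linear_combination he])
    · linear_combination he
  · obtain ⟨x, hx, y, hy, he⟩ := gl_half _ hX2 0
    rw [Finset.mem_image] at hx hy
    obtain ⟨⟨a, b⟩, hx, rfl⟩ := hx
    obtain ⟨⟨c, d⟩, hy, rfl⟩ := hy
    simp only [Finset.mem_product] at hx hy he
    refine ⟨b, d, a, c, hx.2, hy.2, hx.1, hy.1, main _ _ _ _ ?_ ?_⟩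
    · intro h
      apply hneg
      have hd : d ≠ 0 := fun h => h0 (h ▸ hy.2)
      have : (-1 : F) = b * d⁻¹ := by
        field_simp
        linear_combination -h
      rw [this]
      exact hmul _ hx.2 _ (hinv _ hy.2)
    · linear_combination he

/-- Every element is a sum of eight elements of a large multiplicative subgroup. -/
theorem gl_eight {F : Type*} [Field F] [Fintype F] [DecidableEq F] (H : Finset F)
    (h0 : (0 : F) ∉ H) (hmul : ∀ a ∈ H, ∀ b ∈ H, a * b ∈ H) (hinv : ∀ a ∈ H, a⁻¹ ∈ H)
    (hcard : Fintype.card F < H.card ^ 2) (t : F) :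
    ∃ f : Fin 8 → F, (∀ i, f i ∈ H) ∧ ∑ i, f i = t := by
  obtain ⟨u, v, w, z, hu, hv, hw, hz, hX⟩ := gl_four H h0 hmul hinv hcard
  obtain ⟨x, hx, y, hy, he⟩ := gl_half _ hX t
  rw [Finset.mem_image] at hx hy
  obtain ⟨⟨a, b⟩, hx, rfl⟩ := hx
  obtain ⟨⟨c, d⟩, hy, rfl⟩ := hy
  simp only [Finset.mem_product] at hx hy he
  refine ⟨![u * a, v * a, w * b, z * b, u * c, v * c, w * d, z * d], ?_, ?_⟩
  · intro i
    fin_cases i <;> simp <;> apply hmul <;> tauto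
  · simp [Fin.sum_univ_succ]
    linear_combination he


/-- block matrix with a scalar corner -/
def blk {F : Type*} {n : ℕ} (a : F) (x y : Fin n → F) (N : Matrix (Fin n) (Fin n) F) :
    Matrix (Fin (n + 1)) (Fin (n + 1)) F :=
  Matrix.of (Fin.cons (Fin.cons a x : Fin (n + 1) → F)
    (fun i => (Fin.cons (y i) (N i) : Fin (n + 1) → F)))

theorem blk_eta {F : Type*} {n : ℕ} (M : Matrix (Fin (n + 1)) (Fin (n + 1)) F) :
    M = blk (M 0 0) (fun j => M 0 j.succ) (fun i => M i.succ 0) (fun i j => M i.succ j.succ) := by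
  ext i j
  refine Fin.cases ?_ (fun i => ?_) i <;> refine Fin.cases ?_ (fun j => ?_) j <;> simp [blk]

theorem blk_mul {F : Type*} [Field F] {n : ℕ} (a a' : F) (x y x' y' : Fin n → F)
    (N N' : Matrix (Fin n) (Fin n) F) :
    blk a x y N * blk a' x' y' N' =
      blk (a * a' + x ⬝ᵥ y') (a • x' + Matrix.vecMul x N') (a' • y + Matrix.mulVec N y')
        (Matrix.vecMulVec y x' + N * N') := by
  ext i j
  rw [Matrix.mul_apply, Fin.sum_univ_succ]
  refine Fin.cases ?_ (fun i => ?_) i <;> refine Fin.cases ?_ (fun j => ?_) j <;>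
    simp [blk, dotProduct, Matrix.vecMul, Matrix.mulVec, Matrix.vecMulVec, Matrix.mul_apply, mul_comm]

theorem blk_one {F : Type*} [Field F] {n : ℕ} : (1 : Matrix (Fin (n + 1)) (Fin (n + 1)) F) =
    blk 1 0 0 1 := by
  ext i j
  refine Fin.cases ?_ (fun i => ?_) i <;> refine Fin.cases ?_ (fun j => ?_) j <;>
    simp [blk, Matrix.one_apply]
  exact (Fin.succ_ne_zero _).symm

theorem blk_trace {F : Type*} [Field F] {n : ℕ} (a : F) (x y : Fin n → F)
    (N : Matrix (Fin n) (Fin n) F) : (blk a x y N).trace = a + N.trace := by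
  simp [Matrix.trace, Fin.sum_univ_succ, blk]

/-- similarity of matrices -/
def MSim {F : Type*} [Field F] {n : ℕ} (M N : Matrix (Fin n) (Fin n) F) : Prop :=
  ∃ P Q : Matrix (Fin n) (Fin n) F, P * Q = 1 ∧ Q * P = 1 ∧ N = P * M * Q

theorem MSim.refl {F : Type*} [Field F] {n : ℕ} (M : Matrix (Fin n) (Fin n) F) : MSim M M :=
  ⟨1, 1, by simp, by simp, by simp⟩

theorem MSim.trans {F : Type*} [Field F] {n : ℕ} {M N R : Matrix (Fin n) (Fin n) F}
    (h1 : MSim M N) (h2 : MSim N R) : MSim M R := by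
  obtain ⟨P, Q, a, b, rfl⟩ := h1
  obtain ⟨P', Q', a', b', rfl⟩ := h2
  refine ⟨P' * P, Q * Q', ?_, ?_, ?_⟩
  · rw [mul_assoc, ← mul_assoc P, a, one_mul, a']
  · rw [mul_assoc, ← mul_assoc Q', b', one_mul, b]
  · simp only [mul_assoc]

theorem MSim.trace {F : Type*} [Field F] {n : ℕ} {M N : Matrix (Fin n) (Fin n) F}
    (h1 : MSim M N) : N.trace = M.trace := by
  obtain ⟨P, Q, a, b, rfl⟩ := h1
  rw [Matrix.trace_mul_comm, ← mul_assoc, b, one_mul]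

/-- conjugation by a shear -/
theorem blk_shear {F : Type*} [Field F] {n : ℕ} (a : F) (x y z : Fin n → F)
    (N : Matrix (Fin n) (Fin n) F) :
    ∃ x', MSim (blk a x y N) (blk (a + z ⬝ᵥ y) x' y (N - Matrix.vecMulVec y z)) := by
  refine ⟨(a + z ⬝ᵥ y) • (-z) + (x + Matrix.vecMul z N), blk 1 z 0 1, blk 1 (-z) 0 1, ?_, ?_, ?_⟩
  · rw [blk_mul, blk_one]; simp
  · rw [blk_mul, blk_one]; simp
  · rw [blk_mul, blk_mul]
    simp only [one_mul, mul_one, one_smul, dotProduct_zero, add_zero, Matrix.mulVec_zero, smul_zero,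
      zero_add, Matrix.one_mulVec, Matrix.mul_one, Matrix.one_mul, Matrix.vecMulVec_neg,
      Matrix.zero_vecMulVec, Matrix.vecMul_one]
    rw [neg_add_eq_sub]

theorem blk_lift {F : Type*} [Field F] {n : ℕ} (a : F) (x y : Fin n → F)
    {N N' : Matrix (Fin n) (Fin n) F} (h : MSim N N') :
    ∃ x' y', MSim (blk a x y N) (blk a x' y' N') := by
  obtain ⟨P, Q, h1, h2, rfl⟩ := h
  refine ⟨Matrix.vecMul x Q, Matrix.mulVec P y, blk 1 0 0 P, blk 1 0 0 Q, ?_, ?_, ?_⟩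
  · rw [blk_mul, blk_one]; simp [h1]
  · rw [blk_mul, blk_one]; simp [h2]
  · rw [blk_mul, blk_mul]
    simp only [one_mul, mul_one, dotProduct_zero, add_zero, zero_dotProduct, Matrix.zero_vecMulVec, zero_add, Matrix.vecMulVec_zero,
      one_smul, smul_zero, Matrix.mulVec_zero, Matrix.zero_vecMul]

/-- non-scalar -/
def NonSc {F : Type*} [Field F] {n : ℕ} (M : Matrix (Fin n) (Fin n) F) : Prop :=
  ∀ c : F, M ≠ Matrix.scalar (Fin n) c

theorem sim_col {F : Type*} [Field F] {n : ℕ} (M : Matrix (Fin (n + 1)) (Fin (n + 1)) F)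
    (i j : Fin (n + 1)) (hij : i ≠ j) (hM : M i j ≠ 0) :
    ∃ a x y N, y ≠ 0 ∧ MSim M (blk a x y N) := by
  let e : Equiv.Perm (Fin (n + 1)) := Equiv.swap 0 j
  have hs : MSim M (M.submatrix e e) := by
    refine ⟨(1 : Matrix (Fin (n+1)) (Fin (n+1)) F).submatrix e id, (1 : Matrix (Fin (n+1)) (Fin (n+1)) F).submatrix id e, ?_, ?_, ?_⟩
    · rw [← Matrix.submatrix_mul _ _ _ _ _ Function.bijective_id]; simp
    · have := Matrix.submatrix_mul_equiv (1 : Matrix (Fin (n+1)) (Fin (n+1)) F)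
        (1 : Matrix (Fin (n+1)) (Fin (n+1)) F) id e id
      rw [this]; simp
    · ext a b
      simp [Matrix.mul_apply, Matrix.one_apply]
  have hi : e i ≠ 0 := by
    intro h
    have : i = e.symm 0 := by rw [← h, Equiv.symm_apply_apply]
    simp [e] at this
    exact hij this
  obtain ⟨l, hl⟩ := Fin.exists_succ_eq_of_ne_zero hi
  refine ⟨_, _, _, _, ?_, (blk_eta (M.submatrix e e)) ▸ hs⟩
  intro h
  have := congrFun h l
  simp only [hl, Matrix.submatrix_apply, Pi.zero_apply] at this
  apply hM
  simpa [e] using this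

theorem sim_y {F : Type*} [Field F] {n : ℕ} (M : Matrix (Fin (n + 1)) (Fin (n + 1)) F)
    (hM : NonSc M) : ∃ a x y N, y ≠ 0 ∧ MSim M (blk a x y N) := by
  by_cases h : ∃ i j, i ≠ j ∧ M i j ≠ 0
  · obtain ⟨i, j, hij, h⟩ := h
    exact sim_col M i j hij h
  · push Not at h
    have : ∃ i, M i i ≠ M 0 0 := by
      by_contra! hc
      apply hM (M 0 0)
      ext i j
      by_cases hij : i = j
      · subst hij; simp [hc]
      · simp [h i j hij, hij]
    obtain ⟨i, hi⟩ := this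
    have hi0 : i ≠ 0 := by rintro rfl; exact hi rfl
    have hs : MSim M (Matrix.transvection i 0 1 * M * Matrix.transvection i 0 (-1)) := by
      refine ⟨_, _, ?_, ?_, rfl⟩
      · rw [Matrix.transvection_mul_transvection_same _ _ hi0]; simp
      · rw [Matrix.transvection_mul_transvection_same _ _ hi0]; simp
    obtain ⟨a, x, y, N, hy, hsim⟩ := sim_col
      (Matrix.transvection i 0 1 * M * Matrix.transvection i 0 (-1)) i 0 hi0 (by
      rw [Matrix.mul_transvection_apply_same, Matrix.transvection_mul_apply_same,
        Matrix.transvection_mul_apply_same, h i 0 hi0, h 0 i hi0.symm]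
      intro h
      apply hi
      linear_combination -h)
    exact ⟨a, x, y, N, hy, hs.trans hsim⟩

/-- Fillmore: prescribing the diagonal. -/
theorem fillmore {F : Type*} [Field F] : ∀ (n : ℕ) (M : Matrix (Fin n) (Fin n) F), NonSc M →
    ∀ c : Fin n → F, ∑ i, c i = M.trace → ∃ N, MSim M N ∧ ∀ i, N i i = c i := by
  intro n
  induction n with
  | zero => intro M _ c _; exact ⟨M, MSim.refl M, fun i => i.elim0⟩
  | succ n ih =>
    intro M hM c hc
    obtain ⟨a, x, y, N, hy, hs⟩ := sim_y M hM
    obtain ⟨i0, hi0⟩ := Function.ne_iff.1 hy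
    rw [Pi.zero_apply] at hi0
    -- choose z
    have hz : ∃ z : Fin n → F, z ⬝ᵥ y = c 0 - a ∧ (n ≠ 1 → NonSc (N - Matrix.vecMulVec y z)) := by
      let z0 : Fin n → F := Pi.single i0 ((c 0 - a) / y i0)
      have hz0 : z0 ⬝ᵥ y = c 0 - a := by simp [z0, hi0]
      by_cases hn : n = 1
      · exact ⟨z0, hz0, fun h => absurd hn h⟩
      by_cases hN : NonSc (N - Matrix.vecMulVec y z0)
      · exact ⟨z0, hz0, fun _ => hN⟩
      obtain ⟨μ, hμ⟩ : ∃ μ, N - Matrix.vecMulVec y z0 = Matrix.scalar (Fin n) μ := by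
        simpa [NonSc] using hN
      obtain ⟨i1, hi1⟩ : ∃ i1, i1 ≠ i0 := by
        have : Nontrivial (Fin n) := Fin.nontrivial_iff_two_le.2 (by have := i0.2; omega)
        exact exists_ne i0
      let z1 : Fin n → F := Pi.single i1 1 - Pi.single i0 (y i1 / y i0)
      have hz1 : z1 ⬝ᵥ y = 0 := by simp [z1, sub_dotProduct, hi0]
      refine ⟨z0 + z1, by rw [add_dotProduct, hz0, hz1, add_zero], fun _ ν hν => ?_⟩
      rw [Matrix.vecMulVec_add, ← sub_sub, hμ] at hν
      have h1 := congrFun (congrFun hν i0) i1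
      simp only [Matrix.scalar_apply, Matrix.sub_apply, Matrix.vecMulVec_apply, z1, Pi.sub_apply] at h1
      rw [Matrix.diagonal_apply_ne _ hi1.symm, Matrix.diagonal_apply_ne _ hi1.symm] at h1
      simp [hi1] at h1
      exact hi0 h1
    obtain ⟨z, hz, hzN⟩ := hz
    obtain ⟨x', hs2⟩ := blk_shear a x y z N
    rw [hz, add_sub_cancel] at hs2
    have hs3 := hs.trans hs2
    have htr := hs3.trace
    rw [blk_trace, ← hc, Fin.sum_univ_succ, add_right_inj] at htr
    have hex : ∃ N', MSim (N - Matrix.vecMulVec y z) N' ∧ ∀ i, N' i i = c i.succ := by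
      by_cases hn : n = 1
      · subst hn
        refine ⟨_, MSim.refl _, fun i => ?_⟩
        have : i = 0 := Subsingleton.elim _ _
        subst this
        simpa [Matrix.trace] using htr
      · exact ih _ (hzN hn) (fun i => c i.succ) htr.symm
    obtain ⟨N', hN', hd⟩ := hex
    obtain ⟨x2, y2, hs4⟩ := blk_lift (c 0) x' y hN'
    refine ⟨_, hs3.trans hs4, fun i => ?_⟩
    refine Fin.cases ?_ (fun i => ?_) i
    · simp [blk]
    · simpa [blk] using hd i


theorem kroot_of_gcd {K : Type*} [Field K] [Fintype K] (k : ℕ) (v : Kˣ) :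
    ∃ w : Kˣ, w ^ k = v ^ (Nat.gcd k (Fintype.card K - 1)) := by
  classical
  refine ⟨v ^ (Nat.gcdA k (Fintype.card K - 1)), ?_⟩
  have h1 : v ^ (Fintype.card K - 1) = 1 := by
    rw [← Fintype.card_units]; exact pow_card_eq_one
  rw [← zpow_natCast v (Nat.gcd _ _), Nat.gcd_eq_gcd_ab, zpow_add, zpow_mul v (k : ℤ),
    zpow_mul v ((Fintype.card K - 1 : ℕ) : ℤ), zpow_natCast v (Fintype.card K - 1), h1, one_zpow, mul_one, ← zpow_mul,
    ← zpow_natCast, ← zpow_mul, mul_comm]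

theorem char_one_pow {K : Type*} [Field K] [Fintype K] (χ : MulChar K ℂ) (u : Kˣ)
    (hu : χ (u : K) = 1) : ∃ v : Kˣ, v ^ (orderOf χ) = u := by
  obtain ⟨g, hg⟩ := IsCyclic.exists_monoid_generator (α := Kˣ)
  obtain ⟨j, rfl⟩ := Submonoid.mem_powers_iff _ _ |>.1 (hg u)
  have : orderOf χ ∣ j := by
    rw [orderOf_dvd_iff_pow_eq_one]
    apply MulChar.ext
    intro x
    obtain ⟨i, rfl⟩ := Submonoid.mem_powers_iff _ _ |>.1 (hg x)
    rw [MulChar.one_apply_coe, MulChar.pow_apply_coe, Units.val_pow_eq_pow_val, map_pow, ← pow_mul, mul_comm,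
      pow_mul, ← map_pow, ← Units.val_pow_eq_pow_val, hu, one_pow]
  obtain ⟨l, rfl⟩ := this
  exact ⟨g ^ l, by rw [← pow_mul, mul_comm]⟩

theorem norm_jacobi {K : Type*} [Field K] [Fintype K] {χ φ : MulChar K ℂ} (hχ : χ ≠ 1)
    (hφ : φ ≠ 1) : ‖jacobiSum χ φ‖ ≤ Real.sqrt (Fintype.card K) := by
  have h1 : (1 : ℝ) ≤ Fintype.card K := by exact_mod_cast Fintype.card_pos
  by_cases h : χ * φ = 1
  · have : φ = χ⁻¹ := eq_inv_of_mul_eq_one_right h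
    rw [this, jacobiSum_nontrivial_inv hχ, norm_neg]
    have h2 : ‖χ (-1)‖ ^ 2 = 1 := by
      rw [← norm_pow, ← map_pow]; simp
    have : ‖χ (-1)‖ = 1 := by
      have := norm_nonneg (χ (-1))
      nlinarith
    rw [this]
    exact Real.one_le_sqrt.2 h1
  · have hr : ringChar ℂ ≠ ringChar K := by
      rw [ringChar.eq_zero]
      intro h0
      exact CharP.ringChar_ne_zero_of_finite K h0.symm
    have h2 := jacobiSum_mul_jacobiSum_inv hr hχ hφ h
    have hst : ∀ ψ : MulChar K ℂ, ψ⁻¹ = ψ.ringHomComp (starRingEnd ℂ) := by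
      intro ψ
      ext x
      rw [← MulChar.star_apply']
      rfl
    rw [hst, hst, jacobiSum_ringHomComp, Complex.mul_conj] at h2
    have h3 : Complex.normSq (jacobiSum χ φ) = Fintype.card K := by exact_mod_cast h2
    rw [Complex.normSq_eq_norm_sq] at h3
    rw [← h3]
    exact Real.le_sqrt_of_sq_le le_rfl

theorem two_kth_powers {K : Type*} [Field K] [Fintype K] (k : ℕ) (hk : 1 ≤ k)
    (hQ : (k - 1) ^ 4 < Fintype.card K) (c : K) : ∃ x y : K, x ^ k + y ^ k = c := by
  classical
  have hk0 : k ≠ 0 := by omega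
  by_cases hc : c = 0
  · exact ⟨0, 0, by simp [hk0, hc]⟩
  by_contra! hcon
  set D := Nat.gcd k (Fintype.card K - 1) with hD
  have hDpos : 0 < D := Nat.gcd_pos_of_pos_left _ (by omega)
  obtain ⟨χ, hχ⟩ := MulChar.exists_mulChar_orderOf K (Nat.gcd_dvd_right k (Fintype.card K - 1))
    (Complex.isPrimitiveRoot_exp D hDpos.ne')
  rw [← hD] at hχ
  set r : K → ℂ := fun u => ∑ i ∈ Finset.range D, (χ ^ i) u with hr
  have hr0 : r 0 = 0 := by
    simp only [hr]
    exact Finset.sum_eq_zero fun i _ => MulChar.map_zero _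
  have hrne : ∀ u : K, r u ≠ 0 → ∃ x, x ^ k = u := by
    intro u hu
    have hu0 : u ≠ 0 := by rintro rfl; exact hu hr0
    lift u to Kˣ using isUnit_iff_ne_zero.2 hu0
    have h1 : χ (u : K) = 1 := by
      by_contra hne
      apply hu
      have h2 := mul_geom_sum (χ (u : K)) D
      have h3 : χ (u : K) ^ D = 1 := by
        rw [← MulChar.pow_apply_coe, ← hχ, pow_orderOf_eq_one, MulChar.one_apply_coe]
      rw [h3, sub_self] at h2
      simp only [hr, MulChar.pow_apply_coe]
      exact (mul_eq_zero.1 h2).resolve_left (sub_ne_zero.2 hne)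
    obtain ⟨v, hv⟩ := char_one_pow χ u h1
    obtain ⟨w, hw⟩ := kroot_of_gcd k v
    refine ⟨w, ?_⟩
    rw [← hv, hχ, ← hw]; simp
  have hrc : r c = 0 := by
    by_contra h
    obtain ⟨x, hx⟩ := hrne c h
    exact hcon x 0 (by simp [hk0, hx])
  have hz : ∑ u, r (c * u) * r (c * (1 - u)) = 0 := by
    apply Finset.sum_eq_zero
    intro u _
    by_contra h
    obtain ⟨x, hx⟩ := hrne _ (left_ne_zero_of_mul h)
    obtain ⟨y, hy⟩ := hrne _ (right_ne_zero_of_mul h)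
    exact hcon x y (by rw [hx, hy]; ring)
  have hexp : ∑ u, r (c * u) * r (c * (1 - u)) = ∑ i ∈ Finset.range D, ∑ j ∈ Finset.range D,
      (χ ^ i) c * (χ ^ j) c * jacobiSum (χ ^ i) (χ ^ j) := by
    simp only [hr, Finset.sum_mul_sum, map_mul]
    simp only [jacobiSum, Finset.mul_sum]
    rw [Finset.sum_comm]
    refine Finset.sum_congr rfl fun i _ => ?_
    rw [Finset.sum_comm]
    refine Finset.sum_congr rfl fun j _ => Finset.sum_congr rfl fun u _ => ?_
    ring
  obtain ⟨m, hm⟩ : ∃ m, D = m + 1 := ⟨D - 1, by omega⟩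
  have hnt : ∀ i ∈ Finset.range m, χ ^ (i + 1) ≠ 1 := by
    intro i hi h
    have := orderOf_dvd_of_pow_eq_one h
    have := Nat.le_of_dvd (by omega) this
    rw [Finset.mem_range] at hi
    omega
  have hone : (1 : MulChar K ℂ) c = 1 := MulChar.one_apply (isUnit_iff_ne_zero.2 hc)
  have hs : ∑ i ∈ Finset.range m, (χ ^ (i + 1)) c = -1 := by
    have := hrc
    simp only [hr, hm] at this
    rw [Finset.sum_range_succ', pow_zero, hone] at this
    linear_combination this
  have hcnorm : ‖χ c‖ = 1 := by
    lift c to Kˣ using isUnit_iff_ne_zero.2 hc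
    have h3 : χ (c : K) ^ D = 1 := by
      rw [← MulChar.pow_apply_coe, ← hχ, pow_orderOf_eq_one, MulChar.one_apply_coe]
    exact Complex.norm_eq_one_of_pow_eq_one h3 hDpos.ne'
  have hcnorm' : ∀ i, ‖(χ ^ i) c‖ = 1 := by
    intro i
    lift c to Kˣ using isUnit_iff_ne_zero.2 hc
    rw [MulChar.pow_apply_coe, norm_pow, hcnorm, one_pow]
  have hE : (Fintype.card K : ℂ) = - ∑ i ∈ Finset.range m, ∑ j ∈ Finset.range m,
      (χ ^ (i + 1)) c * (χ ^ (j + 1)) c * jacobiSum (χ ^ (i + 1)) (χ ^ (j + 1)) := by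
    rw [hz, hm, Finset.sum_range_succ'] at hexp
    simp only [Finset.sum_range_succ', pow_zero, hone, jacobiSum_one_one] at hexp
    have e1 : ∑ i ∈ Finset.range m, (χ ^ (i + 1)) c * 1 * jacobiSum (χ ^ (i + 1)) 1 = 1 := by
      rw [← neg_inj, ← hs, ← Finset.sum_neg_distrib]
      refine Finset.sum_congr rfl fun i hi => ?_
      rw [jacobiSum_comm, jacobiSum_one_nontrivial (hnt i hi)]; ring
    have e2 : ∑ i ∈ Finset.range m, 1 * (χ ^ (i + 1)) c * jacobiSum 1 (χ ^ (i + 1)) = 1 := by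
      rw [← neg_inj, ← hs, ← Finset.sum_neg_distrib]
      refine Finset.sum_congr rfl fun i hi => ?_
      rw [jacobiSum_one_nontrivial (hnt i hi)]; ring
    rw [Finset.sum_add_distrib, e1, e2] at hexp
    linear_combination -hexp
  have hbound : (Fintype.card K : ℝ) ≤ (m : ℝ) ^ 2 * Real.sqrt (Fintype.card K) := by
    have h1 : ‖(Fintype.card K : ℂ)‖ = Fintype.card K := by simp
    calc (Fintype.card K : ℝ) = _ := h1.symm
      _ = _ := by rw [hE, norm_neg]
      _ ≤ ∑ i ∈ Finset.range m, ∑ j ∈ Finset.range m, Real.sqrt (Fintype.card K) := by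
          refine (norm_sum_le _ _).trans (Finset.sum_le_sum fun i hi => ?_)
          refine (norm_sum_le _ _).trans (Finset.sum_le_sum fun j hj => ?_)
          rw [norm_mul, norm_mul, hcnorm', hcnorm', one_mul, one_mul]
          exact norm_jacobi (hnt i hi) (hnt j hj)
      _ = _ := by
          simp only [Finset.sum_const, Finset.card_range, nsmul_eq_mul]; ring
  have hmk : m ≤ k - 1 := by
    have : D ≤ k := Nat.gcd_le_left _ (by omega)
    omega
  have hQ2 : ((m : ℝ) ^ 2) ^ 2 < Fintype.card K := by
    have : m ^ 4 < Fintype.card K := lt_of_le_of_lt (Nat.pow_le_pow_left hmk 4) hQ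
    have h4 : (m : ℝ) ^ 4 < Fintype.card K := by exact_mod_cast this
    calc ((m : ℝ) ^ 2) ^ 2 = (m : ℝ) ^ 4 := by ring
      _ < _ := h4
  have hlt : (m : ℝ) ^ 2 < Real.sqrt (Fintype.card K) := Real.lt_sqrt_of_sq_lt hQ2
  have hsq := Real.mul_self_sqrt (show (0 : ℝ) ≤ Fintype.card K by positivity)
  nlinarith [sq_nonneg (m : ℝ)]

theorem scalar_case (p : ℕ) (hp : p.Prime)
    (F : Type*) [Field F] [Fintype F] [CharP F p]
    (k n : ℕ) (hk : 1 ≤ k) (hn : 2 ≤ n)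
    (hqn : Fintype.card F ^ n > (k - 1) ^ 4) (c : F) :
    ∃ A B : Matrix (Fin n) (Fin n) F,
      Matrix.scalar (Fin n) c = A ^ k + B ^ k := by
  have : Fact p.Prime := ⟨hp⟩
  have : NeZero n := ⟨by omega⟩
  letI : Fintype (FiniteField.Extension F p n) := Fintype.ofFinite _
  have hcard : Fintype.card (FiniteField.Extension F p n) = Fintype.card F ^ n := by
    rw [← Nat.card_eq_fintype_card, FiniteField.natCard_extension, Nat.card_eq_fintype_card]
  obtain ⟨x, y, hxy⟩ := two_kth_powers (K := FiniteField.Extension F p n) k hk (by rw [hcard]; exact hqn)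
    (algebraMap F _ c)
  let b := Module.finBasisOfFinrankEq F (FiniteField.Extension F p n)
    (FiniteField.finrank_extension F p n)
  refine ⟨Algebra.leftMulMatrix b x, Algebra.leftMulMatrix b y, ?_⟩
  rw [← map_pow, ← map_pow, ← map_add, hxy, AlgHom.commutes]
  rfl

open Polynomial in
theorem kroot_comm {R : Type*} [CommRing R] (p : ℕ) (hp : p.Prime) [CharP R p] (k : ℕ)
    (hpk : ¬ p ∣ k) (x y : R) (hx : IsUnit x) (hxy : IsNilpotent (y ^ k - x)) :
    ∃ z : R, z ^ k = x := by
  have : Fact p.Prime := ⟨hp⟩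
  have : ExpChar R p := ExpChar.prime hp
  obtain ⟨u, rfl⟩ := hx
  -- y ^ k = u * W with W unipotent
  set W : R := ↑u⁻¹ * y ^ k with hW
  have hWn : IsNilpotent (W - 1) := by
    have : W - 1 = ↑u⁻¹ * (y ^ k - u) := by rw [mul_sub, Units.inv_mul]
    rw [this]
    exact (Commute.all _ _).isNilpotent_mul_left hxy
  obtain ⟨N, hN⟩ := hWn
  have hWp : W ^ (p ^ N) = 1 := by
    have h1 : (W - 1) ^ (p ^ N) = 0 :=
      pow_eq_zero_of_le (Nat.lt_pow_self hp.one_lt).le hN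
    rw [sub_pow_char_pow, one_pow] at h1
    exact sub_eq_zero.1 h1
  -- choose l with k * l ≡ -1
  have hcop : Nat.Coprime k (p ^ N) := ((Nat.Prime.coprime_iff_not_dvd hp).2 hpk).symm.pow_right N
  obtain ⟨l, j, hl⟩ : ∃ l j : ℕ, k * l + 1 = p ^ N * j := by
    have hu := (ZMod.isUnit_iff_coprime k (p ^ N)).2 hcop
    obtain ⟨v, hv⟩ := hu
    have : NeZero (p ^ N) := ⟨(pow_pos hp.pos N).ne'⟩
    refine ⟨(-(v⁻¹ : (ZMod (p ^ N))ˣ) : ZMod (p ^ N)).val, ?_⟩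
    have : ((k * (-(v⁻¹ : (ZMod (p ^ N))ˣ) : ZMod (p ^ N)).val + 1 : ℕ) : ZMod (p ^ N)) = 0 := by
      push_cast
      rw [ZMod.natCast_zmod_val, ← hv]
      simp
    exact (ZMod.natCast_eq_zero_iff _ _).1 this
  refine ⟨y * W ^ l, ?_⟩
  have hy : y ^ k = u * W := by rw [hW, Units.mul_inv_cancel_left]
  rw [mul_pow, hy, ← pow_mul, mul_assoc, ← pow_succ', mul_comm l k, hl, pow_mul, hWp, one_pow, mul_one]

open Polynomial in
theorem kroot_matrix {F : Type*} [Field F] [Fintype F] (p : ℕ) (hp : p.Prime) [CharP F p]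
    (k n : ℕ) (hpk : ¬ p ∣ k) (T : Matrix (Fin n) (Fin n) F) (a : Fin n → F)
    (ha0 : ∀ i, a i ≠ 0) (hak : ∀ i, ∃ c, c ^ k = a i)
    (hT : T.charpoly = ∏ i, (X - C (a i))) : ∃ A, A ^ k = T := by
  classical
  by_cases hn : n = 0
  · subst hn
    exact ⟨T, Subsingleton.elim _ _⟩
  let c : F → F := fun x => if h : ∃ c, c ^ k = x then h.choose else 0
  have hc : ∀ i, (c (a i)) ^ k = a i := by
    intro i
    simp only [c, dif_pos (hak i)]
    exact (hak i).choose_spec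
  let f : F[X] := Lagrange.interpolate Finset.univ id c
  have hf : ∀ x, f.eval x = c x := fun x =>
    Lagrange.eval_interpolate_at_node (s := Finset.univ) (v := id) c Function.injective_id.injOn (Finset.mem_univ x)
  let m := T.charpoly
  have hmdeg : m.natDegree ≠ 0 := by
    rw [Matrix.charpoly_natDegree_eq_dim]; simpa using hn
  have : Nontrivial (AdjoinRoot m) := AdjoinRoot.nontrivial m (fun h => hmdeg (natDegree_eq_of_degree_eq_some h))
  have : CharP (AdjoinRoot m) p := charP_of_injective_algebraMap (algebraMap F (AdjoinRoot m)).injective p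
  have hunit : IsUnit (AdjoinRoot.mk m X) := by
    have hcop : IsCoprime (X : F[X]) m := by
      rw [show m = _ from hT]
      apply IsCoprime.prod_right
      intro i _
      have := Polynomial.isCoprime_X_sub_C_of_isUnit_sub (R := F) (a := 0) (b := a i) (by simpa using ha0 i)
      simpa using this
    obtain ⟨s, t, hst⟩ := hcop
    have := congrArg (AdjoinRoot.mk m) hst
    rw [map_add, map_mul, map_mul, AdjoinRoot.mk_self, mul_zero, add_zero, map_one] at this
    exact IsUnit.of_mul_eq_one_right _ this
  have hnil : IsNilpotent ((AdjoinRoot.mk m f) ^ k - AdjoinRoot.mk m X) := by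
    refine ⟨n, ?_⟩
    rw [← map_pow, ← map_sub, ← map_pow, AdjoinRoot.mk_eq_zero, show m = _ from hT]
    have : ∏ i : Fin n, (X - C (a i)) ∣ ∏ i : Fin n, (f ^ k - X) := by
      apply Finset.prod_dvd_prod_of_dvd
      intro i _
      rw [dvd_iff_isRoot]
      simp [IsRoot, hf, hc]
    simpa using this
  obtain ⟨z, hz⟩ := kroot_comm (R := AdjoinRoot m) p hp k hpk (AdjoinRoot.mk m X) (AdjoinRoot.mk m f) hunit hnil
  obtain ⟨g, rfl⟩ := AdjoinRoot.mk_surjective z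
  refine ⟨aeval T g, ?_⟩
  rw [← map_pow, AdjoinRoot.mk_eq_mk] at hz
  obtain ⟨h, hh⟩ := hz
  have := congrArg (aeval T) hh
  rw [map_mul, show aeval T m = 0 from Matrix.aeval_self_charpoly T, zero_mul, map_sub, aeval_X,
    map_pow, sub_eq_zero] at this
  exact this

open Polynomial in
theorem kroot_two {F : Type*} [Field F] [CharP F 2]
    (k n : ℕ) (hpk : ¬ 2 ∣ k) (T : Matrix (Fin n) (Fin n) F)
    (hT : T.charpoly ∣ X * (X - 1) ^ n) : ∃ A, A ^ k = T := by
  have hcop : Nat.Coprime k (2 ^ n) := ((Nat.Prime.coprime_iff_not_dvd Nat.prime_two).2 hpk).symm.pow_right n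
  have h1 : T ^ (2 ^ n + 1) = T := by
    have h2 : T.charpoly ∣ X ^ (2 ^ n + 1) - X := by
      refine hT.trans ?_
      have : (X : F[X]) ^ (2 ^ n + 1) - X = X * (X - 1) ^ (2 ^ n) := by
        rw [sub_pow_char_pow, one_pow]; ring
      rw [this]
      exact mul_dvd_mul_left _ (pow_dvd_pow _ (Nat.lt_two_pow_self).le)
    obtain ⟨h, hh⟩ := h2
    have := congrArg (aeval T) hh
    rw [map_mul, Matrix.aeval_self_charpoly T, zero_mul, map_sub, aeval_X,
      map_pow, sub_eq_zero, aeval_X] at this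
    exact this
  have h2 : ∀ j, T ^ (2 ^ n * j + 1) = T := by
    intro j
    induction j with
    | zero => simp
    | succ j ih => rw [show 2 ^ n * (j + 1) + 1 = (2 ^ n * j + 1) + 2 ^ n by ring, pow_add, ih,
        ← pow_succ', h1]
  obtain ⟨l, j, hl⟩ : ∃ l j : ℕ, 2 ^ n * l + 1 = k * j := by
    have hk0 : k ≠ 0 := by rintro rfl; simp at hpk
    have hu := (ZMod.isUnit_iff_coprime (2 ^ n) k).2 hcop.symm
    obtain ⟨v, hv⟩ := hu
    have : NeZero k := ⟨hk0⟩
    refine ⟨(-(v⁻¹ : (ZMod k)ˣ) : ZMod k).val, ?_⟩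
    have : (((2 ^ n) * (-(v⁻¹ : (ZMod k)ˣ) : ZMod k).val + 1 : ℕ) : ZMod k) = 0 := by
      rw [Nat.cast_add, Nat.cast_mul, ZMod.natCast_zmod_val, ← hv]
      simp
    exact (ZMod.natCast_eq_zero_iff _ _).1 this
  exact ⟨T ^ j, by rw [← pow_mul, mul_comm, ← hl, h2]⟩

open Polynomial in
theorem split_lemma {F : Type*} [Field F] (k n : ℕ) (M : Matrix (Fin n) (Fin n) F)
    (hM : NonSc M) (a b : Fin n → F) (hab : ∑ i, a i + ∑ i, b i = M.trace)
    (ha : ∀ T : Matrix (Fin n) (Fin n) F, T.charpoly = ∏ i, (X - C (a i)) → ∃ A, A ^ k = T)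
    (hb : ∀ T : Matrix (Fin n) (Fin n) F, T.charpoly = ∏ i, (X - C (b i)) → ∃ A, A ^ k = T) :
    ∃ A B : Matrix (Fin n) (Fin n) F, M = A ^ k + B ^ k := by
  obtain ⟨N, ⟨P, Q, hPQ, hQP, hN⟩, hd⟩ := fillmore n M hM (fun i => a i + b i)
    (by rw [Finset.sum_add_distrib, hab])
  let L : Matrix (Fin n) (Fin n) F := Matrix.of fun i j => if j < i then N i j else if i = j then a i else 0
  let U : Matrix (Fin n) (Fin n) F := Matrix.of fun i j => if i < j then N i j else if i = j then b i else 0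
  have hLU : N = L + U := by
    ext i j
    rcases lt_trichotomy i j with h | h | h
    · simp [L, U, h, h.not_gt, h.ne]
    · subst h; simp [L, U, hd]
    · simp [L, U, h, h.not_gt, h.ne']
  have hL : L.charpoly = ∏ i, (X - C (a i)) := by
    rw [← Matrix.charpoly_transpose, Matrix.charpoly_of_isUpperTriangular]
    · simp [L]
    · intro i j hij
      have hij : j < i := hij
      simp [L, hij.not_gt, hij.ne]
  have hU : U.charpoly = ∏ i, (X - C (b i)) := by
    rw [Matrix.charpoly_of_isUpperTriangular]
    · simp [U]
    · intro i j hij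
      have hij : j < i := hij
      simp [U, hij.not_gt, hij.ne']
  obtain ⟨A, hA⟩ := ha L hL
  obtain ⟨B, hB⟩ := hb U hU
  have hpow : ∀ (A : Matrix (Fin n) (Fin n) F) (k : ℕ), (Q * A * P) ^ k = Q * A ^ k * P := by
    intro A k
    induction k with
    | zero => simp [hQP]
    | succ k ih =>
      rw [pow_succ, ih, pow_succ]
      calc Q * A ^ k * P * (Q * A * P) = Q * A ^ k * (P * Q) * A * P := by simp only [mul_assoc]
        _ = _ := by rw [hPQ]; simp only [mul_assoc, one_mul]
  refine ⟨Q * A * P, Q * B * P, ?_⟩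
  rw [hpow, hpow, hA, hB, ← add_mul, ← mul_add, ← hLU, hN]
  calc M = (Q * P) * M * (Q * P) := by rw [hQP]; simp
    _ = _ := by simp only [mul_assoc]

open Polynomial in
theorem case_two (F : Type*) [Field F] [Fintype F] [CharP F 2] (hF : Fintype.card F = 2)
    (k n : ℕ) (hn : 2 ≤ n) (hpk : ¬ 2 ∣ k) (M : Matrix (Fin n) (Fin n) F) (hM : NonSc M) :
    ∃ A B : Matrix (Fin n) (Fin n) F, M = A ^ k + B ^ k := by
  obtain ⟨m, rfl⟩ : ∃ m, n = m + 1 := ⟨n - 1, by omega⟩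
  have h01 : ∀ x : F, x = 0 ∨ x = 1 := by
    intro x
    have := FiniteField.pow_card x
    rw [hF] at this
    have h2 : x * (x - 1) = 0 := by linear_combination this
    rcases mul_eq_zero.1 h2 with h | h
    · exact Or.inl h
    · exact Or.inr (sub_eq_zero.1 h)
  let b0 : F := M.trace - ((m + 1 : ℕ) : F) - (m : F)
  refine split_lemma k (m + 1) M hM (fun _ => 1) (Fin.cons b0 (fun _ => 1)) ?_ ?_ ?_
  · rw [Fin.sum_univ_succ (f := Fin.cons b0 (fun _ => 1))]
    simp [b0]
  · intro T hT
    apply kroot_two k (m + 1) hpk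
    rw [hT]
    simp
  · intro T hT
    apply kroot_two k (m + 1) hpk
    rw [hT, Fin.prod_univ_succ]
    simp only [Fin.cons_zero, Fin.cons_succ, Finset.prod_const, Finset.card_univ, Fintype.card_fin,
      map_one]
    rcases h01 b0 with h | h
    · rw [h, map_zero, sub_zero]
      exact mul_dvd_mul_left _ (pow_dvd_pow _ (Nat.le_succ m))
    · rw [h, map_one, ← pow_succ']
      exact dvd_mul_left _ _

theorem case_big (p : ℕ) (hp : p.Prime) (hp23 : p = 2 ∨ p = 3)
    (F : Type*) [Field F] [Fintype F] [CharP F p]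
    (k n : ℕ) (hk : 1 ≤ k) (hpk : ¬ p ∣ k)
    (d : ℕ) (hd : d = Nat.gcd k (Fintype.card F - 1))
    (hq : Fintype.card F > d ^ 2) (hF : Fintype.card F ≠ 2)
    (hn3 : n > 3) (M : Matrix (Fin n) (Fin n) F) (hM : NonSc M) :
    ∃ A B : Matrix (Fin n) (Fin n) F, M = A ^ k + B ^ k := by
  classical
  have hq1 : 1 < Fintype.card F := Fintype.one_lt_card
  have hdpos : 0 < d := by rw [hd]; exact Nat.gcd_pos_of_pos_left _ (by omega)
  let H0 : Finset Fˣ := Finset.univ.image (fun v => v ^ d)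
  let H : Finset F := H0.image (fun v : Fˣ => (v : F))
  have hdq : d ∣ Fintype.card F - 1 := hd ▸ Nat.gcd_dvd_right _ _
  have hHcard : H.card * d = Fintype.card F - 1 := by
    have h1 : H.card = H0.card := Finset.card_image_of_injective _ Units.val_injective
    have h2 := IsCyclic.card_powMonoidHom_range Fˣ d
    rw [Nat.card_eq_fintype_card (α := Fˣ), Fintype.card_units, Nat.gcd_eq_right hdq] at h2
    have h3 : Nat.card (powMonoidHom d : Fˣ →* Fˣ).range = H0.card := by
      have h4 : ((powMonoidHom d : Fˣ →* Fˣ).range : Set Fˣ) = (H0 : Set Fˣ) := by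
        ext x; simp [H0]
      exact (congrArg (fun s : Set Fˣ => Nat.card s) h4).trans (by simp)
    rw [h1, ← h3, h2, Nat.div_mul_cancel hdq]
  have hmem : ∀ x : F, x ∈ H ↔ ∃ v : Fˣ, ((v ^ d : Fˣ) : F) = x := by
    intro x; simp [H, H0]
  have hH0 : (0 : F) ∉ H := by
    rw [hmem]; rintro ⟨v, hv⟩; exact Units.ne_zero _ hv
  have hbig : Fintype.card F < H.card ^ 2 := by
    have hne : H.card ≠ d := by
      intro he
      rw [he] at hHcard
      have hqd : Fintype.card F = d * d + 1 := by omega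
      obtain ⟨m, _, hm⟩ := FiniteField.card F p
      rcases hp23 with rfl | rfl
      · obtain ⟨j, hj⟩ : ∃ j, (m : ℕ) = j + 2 := by
          have : (m : ℕ) ≠ 1 := by
            intro h1; rw [h1] at hm; exact hF (by simpa using hm)
          have := m.pos
          exact ⟨m - 2, by omega⟩
        rw [hj, pow_add] at hm
        have h4 : (d * d + 1) % 4 = 0 := by rw [← hqd, hm]; omega
        have : d % 4 < 4 := Nat.mod_lt _ (by norm_num)
        rw [Nat.add_mod, Nat.mul_mod] at h4
        interval_cases d % 4 <;> simp at h4
      · obtain ⟨j, hj⟩ : ∃ j, (m : ℕ) = j + 1 := ⟨m - 1, by have := m.pos; omega⟩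
        rw [hj, pow_add] at hm
        have h4 : (d * d + 1) % 3 = 0 := by rw [← hqd, hm]; omega
        have : d % 3 < 3 := Nat.mod_lt _ (by norm_num)
        rw [Nat.add_mod, Nat.mul_mod] at h4
        interval_cases d % 3 <;> simp at h4
    have hqe : Fintype.card F = H.card * d + 1 := by omega
    have hle : d ≤ H.card := by
      by_contra hlt
      push Not at hlt
      nlinarith
    have hlt : d + 1 ≤ H.card := by omega
    nlinarith
  obtain ⟨m, rfl⟩ : ∃ m, n = 4 + m := ⟨n - 4, by omega⟩
  obtain ⟨f, hfH, hfs⟩ := gl_eight H hH0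
    (by
      intro x hx y hy
      rw [hmem] at *
      obtain ⟨v, rfl⟩ := hx
      obtain ⟨w, rfl⟩ := hy
      exact ⟨v * w, by simp [mul_pow]⟩)
    (by
      intro x hx
      rw [hmem] at *
      obtain ⟨v, rfl⟩ := hx
      exact ⟨v⁻¹, by simp⟩) hbig (M.trace - 2 * (m : F))
  have h1H : (1 : F) ∈ H := (hmem 1).2 ⟨1, by simp⟩
  have hHk : ∀ x ∈ H, ∃ c, c ^ k = x := by
    intro x hx
    obtain ⟨v, rfl⟩ := (hmem x).1 hx
    obtain ⟨w, hw⟩ := kroot_of_gcd k v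
    exact ⟨w, by rw [hd, ← hw]; simp⟩
  have fin : ∀ g : Fin 4 → F, (∀ i, g i ∈ H) → ∀ i,
      (Fin.append g (fun _ : Fin m => (1 : F))) i ∈ H := by
    intro g hg i
    refine Fin.addCases (fun i => ?_) (fun i => ?_) i
    · rw [Fin.append_left]; exact hg i
    · rw [Fin.append_right]; exact h1H
  have key : ∀ g : Fin 4 → F, (∀ i, g i ∈ H) → ∀ T : Matrix (Fin (4 + m)) (Fin (4 + m)) F,
      T.charpoly = ∏ i, (Polynomial.X - Polynomial.C ((Fin.append g (fun _ : Fin m => (1 : F))) i)) →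
      ∃ A, A ^ k = T := by
    intro g hg T hT
    exact kroot_matrix p hp k (4 + m) hpk T _ (fun i h => hH0 (h ▸ fin g hg i))
      (fun i => hHk _ (fin g hg i)) hT
  refine split_lemma k (4 + m) M hM
    (Fin.append (fun i : Fin 4 => f (Fin.castAdd 4 i)) (fun _ : Fin m => 1))
    (Fin.append (fun i : Fin 4 => f (Fin.natAdd 4 i)) (fun _ : Fin m => 1)) ?_
    (key _ fun i => hfH _) (key _ fun i => hfH _)
  have h8 : ∑ i : Fin 4, f (Fin.castAdd 4 i) + ∑ i : Fin 4, f (Fin.natAdd 4 i) =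
      M.trace - 2 * (m : F) := by
    rw [← hfs]; exact (Fin.sum_univ_add (a := 4) (b := 4) f).symm
  rw [Fin.sum_univ_add, Fin.sum_univ_add]
  simp only [Fin.append_left, Fin.append_right, Finset.sum_const, Finset.card_univ, Fintype.card_fin,
    nsmul_eq_mul, mul_one]
  linear_combination h8

theorem stmt15 (p : ℕ) (hp : p.Prime) (hp23 : p = 2 ∨ p = 3)
    (F : Type*) [Field F] [Fintype F] [CharP F p]
    (k n : ℕ) (hk : 1 ≤ k) (hn : 2 ≤ n) (hpk : ¬ p ∣ k)
    (d : ℕ) (hd : d = Nat.gcd k (Fintype.card F - 1))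
    (hq : Fintype.card F > d ^ 2)
    (hn3 : n > 3) (hqn : Fintype.card F ^ n > (k - 1) ^ 4) :
    ∀ M : Matrix (Fin n) (Fin n) F, ∃ A B : Matrix (Fin n) (Fin n) F,
      M = A ^ k + B ^ k := by
  intro M
  by_cases hM : NonSc M
  · by_cases hF : Fintype.card F = 2
    · have hp2 : p = 2 := by
        rcases hp23 with h | h
        · exact h
        · subst h
          obtain ⟨m, _, hm⟩ := FiniteField.card F 3
          have h3 : 3 ∣ 3 ^ (m : ℕ) := dvd_pow_self 3 m.ne_zero
          rw [← hm, hF] at h3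
          omega
      subst hp2
      exact case_two F hF k n hn hpk M hM
    · exact case_big p hp hp23 F k n hk hpk d hd hq hF hn3 M hM
  · obtain ⟨c, rfl⟩ : ∃ c, M = Matrix.scalar (Fin n) c := by
      simpa [NonSc] using hM
    exact scalar_case p hp F k n hk hn hqn c
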